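/- For β with 0 < β < 2√π, the identity (1/√(2π))·∑_{n=1}^∞ n^{3/2}·e^{-nβ²/2} = 3/β⁵ + (1/√(2π))·∑_{r=0}^∞ ζ(−3/2 − r)·(−β²/2)^r / r! holds, where ζ is the analytically continued Riemann zeta function. -/

import Mathlib

open Real MeasureTheory Set

lemma aux_congr {f g : ℕ → ℂ} {a : ℂ} (h : ∀ n, f n = g n) : HasSum f a ↔ HasSum g a := by
  rw [funext h]

lemma aux_binom {u : ℂ} (hu : ‖u‖ < 1) :
    HasSum (fun r : ℕ => Ring.choose (-(5/2) : ℂ) r * u ^ r) ((1 + u) ^ (-(5/2) : ℂ)) := by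
  have h := (Complex.one_add_cpow_hasFPowerSeriesOnBall_zero (a := (-(5/2) : ℂ))).hasSum
    (y := u) (by rw [← ENNReal.ofReal_one, Metric.eball_ofReal]; simpa using hu)
  rw [zero_add] at h
  simp only [binomialSeries_apply, List.ofFn_const, List.prod_replicate, smul_eq_mul] at h
  exact h

lemma aux_gamma (r : ℕ) : Complex.Gamma (5/2) * Ring.choose (-(5/2) : ℂ) r
    = (-1) ^ r * Complex.Gamma (5/2 + r) / r.factorial := by
  have h : ∀ r : ℕ, Complex.Gamma (5/2) * (descPochhammer ℤ r).smeval (-(5/2) : ℂ)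
      = (-1) ^ r * Complex.Gamma (5/2 + r) := by
    intro r
    induction r with
    | zero => simp
    | succ n ih =>
      have e : (descPochhammer ℤ (n+1)).smeval (-(5/2) : ℂ)
          = (descPochhammer ℤ n).smeval (-(5/2) : ℂ) * (-(5/2) - n) := by
        simp [descPochhammer_succ_right, Polynomial.smeval_mul, Polynomial.smeval_natCast]
      have hne : (5/2 + n : ℂ) ≠ 0 := by
        intro h
        have := congrArg Complex.re h
        norm_num at this
        have h2 : (0:ℝ) ≤ n := Nat.cast_nonneg n
        linarith
      rw [e, ← mul_assoc, ih]
      push_cast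
      rw [← add_assoc, Complex.Gamma_add_one _ hne]
      ring
  rw [Ring.choose_eq_smul, ← h r, smul_eq_mul]
  field_simp

lemma aux_mulcpow {k x s : ℝ} (hk : 0 < k) (hs : s = 1 ∨ s = -1) :
    ((x : ℂ) + k * s * Complex.I) ^ (-(5/2) : ℂ) =
      (k : ℂ) ^ (-(5/2) : ℂ) * Complex.exp (-(5/2) * (s * π / 2 * Complex.I)) *
        (1 + (-(s * Complex.I) * (x / k : ℝ))) ^ (-(5/2) : ℂ) := by
  have hkc : (k : ℂ) ≠ 0 := by exact_mod_cast hk.ne'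
  have hw0 : (1 + (-(s * Complex.I) * (x / k : ℝ)) : ℂ) ≠ 0 := by
    intro h
    have := congrArg Complex.re h
    simp at this
  set w : ℂ := 1 + (-(s * Complex.I) * (x / k : ℝ)) with hw
  have hs2 : (s : ℂ) * s = 1 := by rcases hs with h | h <;> simp [h]
  have hs0 : (s : ℂ) ≠ 0 := by rcases hs with h | h <;> simp [h]
  have hsi : (s : ℂ) * Complex.I ≠ 0 := mul_ne_zero hs0 Complex.I_ne_zero
  have e : (x : ℂ) + k * s * Complex.I = (k : ℝ) * ((s * Complex.I) * w) := by
    rw [hw]; push_cast; field_simp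
    linear_combination ((x : ℂ) * s ^ 2) * Complex.I_sq + (-(x:ℂ)) * hs2
  have hlogsi : Complex.log (s * Complex.I) = s * π / 2 * Complex.I := by
    rcases hs with h | h
    · simp [h, Complex.log_I]
    · simp [h, Complex.log_neg_I]; ring
  have hargsi : Complex.arg (s * Complex.I) = s * π / 2 := by
    rcases hs with h | h
    · simp [h]
    · simp [h]; ring
  have hl : Complex.log ((s * Complex.I) * w) = Complex.log (s * Complex.I) + Complex.log w := by
    apply Complex.log_mul hsi hw0
    have h1 : |Complex.arg w| < π / 2 :=
      Complex.abs_arg_lt_pi_div_two_iff.2 (Or.inl (by simp [hw]))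
    rw [abs_lt] at h1
    rw [hargsi]
    have := Real.pi_pos
    rcases hs with h | h <;> subst h <;> constructor <;> linarith
  have hne : (k : ℂ) * ((s * Complex.I) * w) ≠ 0 := mul_ne_zero hkc (mul_ne_zero hsi hw0)
  rw [e, Complex.cpow_def_of_ne_zero hne, Complex.log_ofReal_mul hk (mul_ne_zero hsi hw0), hl,
    hlogsi, Complex.cpow_def_of_ne_zero hkc, Complex.cpow_def_of_ne_zero hw0,
    ← Complex.exp_add, ← Complex.exp_add, Complex.ofReal_log hk.le]
  congr 1; ring

lemma aux_swap {x s : ℝ} (hx : 0 < x) (hx2 : x < 2 * π) (hs : s = 1 ∨ s = -1) :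
    ∃ A : ℂ, HasSum (fun k : ℕ => ((x : ℂ) + (2 * π * (k + 1) : ℝ) * s * Complex.I) ^ (-(5/2) : ℂ)) A ∧
      HasSum (fun r : ℕ => Ring.choose (-(5/2) : ℂ) r * (2 * π : ℂ) ^ (-(5/2) : ℂ) *
        Complex.exp (-(5/2) * (s * π / 2 * Complex.I)) * (-(s * Complex.I)) ^ r * (x / (2 * π)) ^ r *
        riemannZeta (5/2 + r)) A := by
  have hpi := Real.pi_pos
  have hpos : ∀ k : ℕ, 0 < 2 * π * ((k : ℝ) + 1) := fun k => by positivity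
  have hns : ‖(s : ℂ)‖ = 1 := by rcases hs with h | h <;> simp [h]
  set F : ℕ × ℕ → ℂ := fun p => ((2 * π * (p.1 + 1) : ℝ) : ℂ) ^ (-(5/2) : ℂ) *
    Complex.exp (-(5/2) * (s * π / 2 * Complex.I)) *
    (Ring.choose (-(5/2) : ℂ) p.2 * (-(s * Complex.I) * (x / (2 * π * (p.1 + 1)) : ℝ)) ^ p.2) with hF
  have hy : ‖((x / (2 * π) : ℝ) : ℂ)‖ < 1 := by
    rw [Complex.norm_real, Real.norm_of_nonneg (by positivity), div_lt_one (by positivity)]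
    exact hx2
  have hle : ∀ k : ℕ, x / (2 * π * ((k : ℝ) + 1)) ≤ x / (2 * π) := fun k => by
    apply div_le_div_of_nonneg_left hx.le (by positivity)
    have : (0 : ℝ) ≤ k := Nat.cast_nonneg k
    nlinarith
  have hB := (aux_binom hy).summable.norm
  have hA : Summable (fun k : ℕ => ‖((2 * π * (k + 1) : ℝ) : ℂ) ^ (-(5/2) : ℂ)‖) := by
    have h1 : Summable (fun k : ℕ => ((k + 1 : ℕ) : ℝ) ^ (-(5/2) : ℝ)) :=
      (summable_nat_add_iff 1).2 (Real.summable_nat_rpow.2 (by norm_num))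
    refine (h1.mul_left ((2 * π) ^ (-(5/2) : ℝ))).congr fun k => ?_
    rw [Complex.norm_cpow_eq_rpow_re_of_pos (hpos k)]
    rw [← Real.mul_rpow (by positivity) (by positivity)]
    congr 1
    · push_cast; ring
    · norm_num
  have hE : ‖Complex.exp (-(5/2) * (s * π / 2 * Complex.I))‖ = 1 := by
    rw [Complex.norm_exp]; simp
  have hFs : Summable F := by
    refine Summable.of_norm_bounded (hA.mul_of_nonneg hB (fun _ => norm_nonneg _)
      (fun _ => norm_nonneg _)) ?_
    rintro ⟨k, r⟩
    simp only [hF, norm_mul, hE, mul_one, norm_pow, norm_neg, hns, Complex.norm_I, one_mul]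
    gcongr
    rw [Complex.norm_real, Complex.norm_real, Real.norm_of_nonneg, Real.norm_of_nonneg]
    · exact hle k
    · positivity
    · exact div_nonneg hx.le (hpos k).le
  refine ⟨∑' p, F p, ?_, ?_⟩
  · refine hFs.hasSum.prod_fiberwise fun k => ?_
    rw [aux_mulcpow (hpos k) hs]
    simp only [hF]
    refine HasSum.mul_left (((2 * π * (k + 1) : ℝ) : ℂ) ^ (-(5/2) : ℂ) *
      Complex.exp (-(5/2) * (s * π / 2 * Complex.I))) (aux_binom ?_)
    rw [norm_mul, norm_neg, norm_mul, hns, Complex.norm_I, Complex.norm_real, Real.norm_of_nonneg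
      (div_nonneg hx.le (hpos k).le), one_mul, one_mul]
    refine (hle k).trans_lt ?_
    rwa [div_lt_one (by positivity)]
  · have hsw : HasSum (fun p : ℕ × ℕ => F (p.2, p.1)) (∑' p, F p) :=
      (Equiv.prodComm ℕ ℕ).hasSum_iff.2 hFs.hasSum
    refine hsw.prod_fiberwise fun r => ?_
    clear hsw hFs hA hB
    clear_value F
    subst hF
    have hre : 1 < ((5/2 + r : ℂ)).re := by
      have : (0 : ℝ) ≤ r := Nat.cast_nonneg r
      norm_num; linarith
    have hz : HasSum (fun n : ℕ => 1 / ((n : ℂ) + 1) ^ (5/2 + r : ℂ)) (riemannZeta (5/2 + r)) := by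
      rw [zeta_eq_tsum_one_div_nat_add_one_cpow hre]
      apply Summable.hasSum
      have := (summable_nat_add_iff 1).2 (Complex.summable_one_div_nat_cpow.2 hre)
      simpa using this
    have hz2 := hz.mul_left (Ring.choose (-(5/2) : ℂ) r * (2 * π : ℂ) ^ (-(5/2) : ℂ) *
        Complex.exp (-(5/2) * (s * π / 2 * Complex.I)) * (-(s * Complex.I)) ^ r *
        (x / (2 * π)) ^ r)
    refine (aux_congr fun k => ?_).2 hz2
    have hk0 : ((k : ℂ) + 1) ≠ 0 := Nat.cast_add_one_ne_zero k
    have hpc : (π : ℂ) ≠ 0 := by exact_mod_cast hpi.ne'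
    simp only []
    rw [Complex.ofReal_mul, Complex.mul_cpow_ofReal_nonneg (by positivity) (by positivity)]
    rw [Complex.cpow_add _ _ hk0, Complex.cpow_natCast]
    push_cast
    rw [Complex.cpow_neg ((k : ℂ) + 1), show -((s : ℂ) * Complex.I) * (x / (2 * π * (k + 1)))
      = -(s * Complex.I) * (x / (2 * π)) / (k + 1) by field_simp, div_pow, mul_pow]
    ring

lemma aux_integrable {b : ℝ} (hb : 0 < b) :
    IntegrableOn (fun t : ℝ => t ^ (3/2 : ℝ) * rexp (-b * t)) (Ioi 0) := by
  simpa using integrableOn_rpow_mul_exp_neg_mul_rpow (p := 1) (s := 3/2) (b := b)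
    (by norm_num) one_pos hb

lemma aux_laplace {z : ℂ} (hz : 0 < z.re) :
    ∫ t in Ioi (0 : ℝ), ((t ^ (3/2 : ℝ) : ℝ) : ℂ) * Complex.exp (-(z * t))
      = z ^ (-(5/2) : ℂ) * Complex.Gamma (5/2) := by
  set d : ℝ → NNReal := fun t => Real.toNNReal (t ^ (3/2 : ℝ)) with hd
  have hdm : Measurable d := by fun_prop
  set μ : Measure ℝ := (volume.restrict (Ioi 0)).withDensity (fun t => (d t : ENNReal)) with hμ
  have hset : Iio (0 : ℝ) ⊆ interior (ProbabilityTheory.integrableExpSet (fun t => t) μ) := by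
    apply interior_maximal _ isOpen_Iio
    intro b hb
    show Integrable _ μ
    rw [hμ, integrable_withDensity_iff_integrable_smul hdm]
    refine (aux_integrable (b := -b) (by simpa using hb)).congr ?_
    filter_upwards [ae_restrict_mem measurableSet_Ioi] with t ht
    have : 0 ≤ t ^ (3/2 : ℝ) := Real.rpow_nonneg (le_of_lt ht) _
    simp [hd, NNReal.smul_def, Real.coe_toNNReal _ this]
  have hG : ∀ w : ℂ, ProbabilityTheory.complexMGF (fun t => t) μ (-w)
      = ∫ t in Ioi (0 : ℝ), ((t ^ (3/2 : ℝ) : ℝ) : ℂ) * Complex.exp (-(w * t)) := by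
    intro w
    rw [ProbabilityTheory.complexMGF, hμ, integral_withDensity_eq_integral_smul hdm]
    refine setIntegral_congr_fun measurableSet_Ioi fun t ht => ?_
    have : 0 ≤ t ^ (3/2 : ℝ) := Real.rpow_nonneg (le_of_lt ht) _
    simp [hd, NNReal.smul_def, Real.coe_toNNReal _ this]
  have hopen : IsOpen {w : ℂ | 0 < w.re} := isOpen_lt continuous_const Complex.continuous_re
  have h1 : AnalyticOnNhd ℂ (fun w => ProbabilityTheory.complexMGF (fun t => t) μ (-w))
      {w : ℂ | 0 < w.re} := by
    apply DifferentiableOn.analyticOnNhd _ hopen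
    apply (ProbabilityTheory.differentiableOn_complexMGF (X := fun t => t) (μ := μ)).comp
      (differentiableOn_neg _)
    intro w hw
    exact hset (by simpa using hw)
  have h2 : AnalyticOnNhd ℂ (fun w : ℂ => w ^ (-(5/2) : ℂ) * Complex.Gamma (5/2))
      {w : ℂ | 0 < w.re} := by
    apply DifferentiableOn.analyticOnNhd _ hopen
    intro w hw
    apply DifferentiableAt.differentiableWithinAt
    apply DifferentiableAt.mul_const
    exact differentiableAt_id.cpow_const (Or.inl hw)
  have hreal : ∀ r : ℝ, 0 < r → ProbabilityTheory.complexMGF (fun t => t) μ (-(r : ℂ))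
      = (r : ℂ) ^ (-(5/2) : ℂ) * Complex.Gamma (5/2) := by
    intro r hr
    rw [hG]
    have := Complex.integral_cpow_mul_exp_neg_mul_Ioi (a := 5/2) (by norm_num) hr
    rw [one_div, Complex.inv_cpow, ← Complex.cpow_neg] at this
    · rw [← this]
      refine setIntegral_congr_fun measurableSet_Ioi fun t ht => ?_
      rw [Complex.ofReal_cpow (le_of_lt ht)]
      norm_num
    · rw [Complex.arg_ofReal_of_nonneg hr.le]; exact Real.pi_pos.ne
  have hconv : IsPreconnected {w : ℂ | 0 < w.re} := (convex_halfSpace_re_gt 0).isPreconnected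
  have := h1.eqOn_of_preconnected_of_frequently_eq h2 hconv (z₀ := 1) (by simp) ?_ hz
  · rw [← hG]; exact this
  · have ht : Filter.Tendsto (fun n : ℕ => ((1 + 1 / ((n : ℝ) + 1) : ℝ) : ℂ)) Filter.atTop
        (nhdsWithin 1 {1}ᶜ) := by
      apply tendsto_nhdsWithin_of_tendsto_nhds_of_eventually_within
      · have h := (tendsto_one_div_add_atTop_nhds_zero_nat (𝕜 := ℝ)).const_add 1
        have h' := (Complex.continuous_ofReal.tendsto _).comp h
        simpa [Function.comp_def] using h'
      · refine Filter.Eventually.of_forall fun n => ?_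
        have : (0 : ℝ) < 1 / ((n : ℝ) + 1) := by positivity
        simp only [mem_compl_iff, mem_singleton_iff]
        intro h
        have h3 : (1 + 1 / ((n : ℝ) + 1) : ℝ) = 1 := by exact_mod_cast h
        linarith
    refine ht.frequently (Filter.Frequently.of_forall fun n => ?_)
    exact hreal _ (by positivity)

lemma aux_poisson {x : ℝ} (hx : 0 < x)
    (hsum : Summable fun n : ℤ => ((x : ℂ) + 2 * π * n * Complex.I) ^ (-(5/2) : ℂ)) :
    ((∑' n : ℕ, ((n : ℝ) + 1) ^ (3/2 : ℝ) * rexp (-((n : ℝ) + 1) * x) : ℝ) : ℂ)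
      = (∑' n : ℤ, ((x : ℂ) + 2 * π * n * Complex.I) ^ (-(5/2) : ℂ)) * Complex.Gamma (5/2) := by
  set f : ℝ → ℂ := fun t => (((max t 0) ^ (3/2 : ℝ) * rexp (-x * t) : ℝ) : ℂ) with hf
  have hfneg : ∀ t ≤ 0, f t = 0 := by
    intro t ht
    simp only [hf]
    rw [max_eq_right ht, Real.zero_rpow (by norm_num)]; simp
  have hfpos : ∀ t, 0 < t → f t = ((t ^ (3/2 : ℝ) * rexp (-x * t) : ℝ) : ℂ) := by
    intro t ht
    simp only [hf]
    rw [max_eq_left ht.le]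
  have hc : Continuous f := by
    apply Complex.continuous_ofReal.comp
    apply Continuous.mul
    · exact (continuous_id.max continuous_const).rpow_const fun _ => Or.inr (by norm_num)
    · fun_prop
  have hO : f =O[Filter.cocompact ℝ] (fun t : ℝ => |t| ^ (-(2 : ℝ))) := by
    rw [cocompact_eq_atBot_atTop, Asymptotics.isBigO_sup]
    constructor
    · refine Asymptotics.IsBigO.of_bound 1 ?_
      filter_upwards [Filter.eventually_le_atBot 0] with t ht
      rw [hfneg t ht]; simp; positivity
    · have h := (isLittleO_exp_neg_mul_rpow_atTop hx (-(7/2))).isBigO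
      have h2 := (Asymptotics.isBigO_refl (fun t : ℝ => t ^ (3/2 : ℝ)) Filter.atTop).mul h
      have h3 : f =O[Filter.atTop] (fun t : ℝ => t ^ (3/2 : ℝ) * rexp (-x * t)) := by
        refine Asymptotics.IsBigO.of_bound 1 ?_
        filter_upwards [Filter.eventually_gt_atTop 0] with t ht
        rw [hfpos t ht, Complex.norm_real, one_mul]
      refine (h3.trans h2).congr' Filter.EventuallyEq.rfl ?_
      filter_upwards [Filter.eventually_gt_atTop 0] with t ht
      rw [← Real.rpow_add ht, abs_of_pos ht]; norm_num
  have hF : ∀ n : ℤ, FourierTransform.fourier f (n : ℝ)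
      = ((x : ℂ) + 2 * π * n * Complex.I) ^ (-(5/2) : ℂ) * Complex.Gamma (5/2) := by
    intro n
    rw [Real.fourier_real_eq_integral_exp_smul, ← aux_laplace (by simp [hx]),
      ← setIntegral_eq_integral_of_forall_compl_eq_zero (s := Ioi 0)]
    · refine setIntegral_congr_fun measurableSet_Ioi fun t ht => ?_
      rw [hfpos t ht]
      push_cast
      rw [smul_eq_mul, mul_left_comm, ← Complex.exp_add]
      congr 2; ring
    · intro t ht
      rw [hfneg t (by simpa using ht), smul_zero]
  have hP := Real.tsum_eq_tsum_fourier_of_rpow_decay_of_summable hc one_lt_two hO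
    (by simp only [hF]; exact hsum.mul_right _) 0
  simp only [hF, zero_add] at hP
  have hL : ∑' n : ℤ, f n = ∑' n : ℕ, f ((n : ℝ) + 1) := by
    have hinj : Function.Injective (fun n : ℕ => (n : ℤ) + 1) := by
      intro a b h; simpa using h
    rw [← hinj.tsum_eq]
    · simp
    · intro m hm
      by_contra hcon
      apply hm
      apply hfneg
      by_contra hlt
      push Not at hlt
      have : 0 < m := by exact_mod_cast hlt
      exact hcon ⟨(m - 1).toNat, by simp; omega⟩
  rw [hL] at hP
  rw [← tsum_mul_right]
  rw [Complex.ofReal_tsum]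
  convert hP using 1
  · congr 1; ext n
    rw [hfpos _ (by positivity)]
    congr 3; ring
  · simp

lemma aux_main {x : ℝ} (hx : 0 < x) (hx2 : x < 2 * π) :
    ∑' n : ℕ, ((n : ℝ) + 1) ^ (3/2 : ℝ) * rexp (-((n : ℝ) + 1) * x)
      = x ^ (-(5/2) : ℝ) * Real.Gamma (5/2) +
        ∑' r : ℕ, (riemannZeta (-3 / 2 - (r : ℂ))).re * (-x) ^ r / r.factorial := by
  obtain ⟨A, hA, hA'⟩ := aux_swap hx hx2 (Or.inl rfl : (1 : ℝ) = 1 ∨ (1 : ℝ) = -1)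
  obtain ⟨B, hB, hB'⟩ := aux_swap hx hx2 (Or.inr rfl : (-1 : ℝ) = 1 ∨ (-1 : ℝ) = -1)
  have hZ : HasSum (fun n : ℤ => ((x : ℂ) + 2 * π * n * Complex.I) ^ (-(5/2) : ℂ))
      (A + (x : ℂ) ^ (-(5/2) : ℂ) + B) := by
    have h := HasSum.of_add_one_of_neg_add_one
      (f := fun n : ℤ => ((x : ℂ) + 2 * π * n * Complex.I) ^ (-(5/2) : ℂ)) (m := A) (m' := B)
      ((aux_congr fun k => by push_cast; ring_nf).1 hA)
      ((aux_congr fun k => by push_cast; ring_nf).1 hB)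
    simpa using h
  have hP := aux_poisson hx hZ.summable
  rw [hZ.tsum_eq] at hP
  have hR : HasSum (fun r : ℕ => riemannZeta (-3 / 2 - (r : ℂ)) *
      (((-x) ^ r / r.factorial : ℝ) : ℂ)) ((A + B) * Complex.Gamma (5/2)) := by
    refine (aux_congr fun r => ?_).1 ((hA'.add hB').mul_right (Complex.Gamma (5/2)))
    have hr0 : (0 : ℝ) ≤ r := Nat.cast_nonneg r
    have hfe := riemannZeta_one_sub (s := 5/2 + r) (by
      intro n h
      have := congrArg Complex.re h
      norm_num at this
      have : (0 : ℝ) ≤ n := Nat.cast_nonneg n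
      linarith) (by
      intro h
      have := congrArg Complex.re h
      norm_num at this
      linarith)
    have h2pi : (2 * π : ℂ) ≠ 0 := by
      exact_mod_cast (by positivity : (2 * π : ℝ) ≠ 0)
    have hcos : 2 * Complex.cos (π * (5/2 + r) / 2) =
        Complex.exp (-(5/2) * ((1 : ℝ) * π / 2 * Complex.I)) * (-((1 : ℝ) * Complex.I)) ^ r +
        Complex.exp (-(5/2) * ((-1 : ℝ) * π / 2 * Complex.I)) * (-((-1 : ℝ) * Complex.I)) ^ r := by
      have e1 : (-((1 : ℝ) * Complex.I) : ℂ) = Complex.exp (-(π / 2 * Complex.I)) := by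
        rw [Complex.exp_neg, Complex.exp_pi_div_two_mul_I]; simp
      have e2 : (-((-1 : ℝ) * Complex.I) : ℂ) = Complex.exp (π / 2 * Complex.I) := by
        rw [Complex.exp_pi_div_two_mul_I]; simp
      rw [e1, e2, ← Complex.exp_nat_mul, ← Complex.exp_nat_mul, ← Complex.exp_add,
        ← Complex.exp_add, Complex.two_cos, add_comm]
      congr 2 <;> push_cast <;> ring
    have e3 : (-3 / 2 - (r : ℂ)) = 1 - (5/2 + r) := by ring
    have e4 : (2 * π : ℂ) ^ (-(5/2 + r) : ℂ) = (2 * π : ℂ) ^ (-(5/2) : ℂ) / (2 * π) ^ r := by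
      rw [neg_add, Complex.cpow_add _ _ h2pi, Complex.cpow_neg _ (r : ℂ), Complex.cpow_natCast,
        ← div_eq_mul_inv]
    have hg := aux_gamma r
    rw [e3, hfe, e4]
    rw [neg_pow x r]
    push_cast
    push_cast at hcos
    rw [div_pow]
    linear_combination ((2 * π : ℂ) ^ (-(5/2) : ℂ) * (x ^ r / (2 * π) ^ r) * riemannZeta (5/2 + r) *
      (Complex.exp (-(5/2) * (1 * π / 2 * Complex.I)) * (-(1 * Complex.I)) ^ r +
        Complex.exp (-(5/2) * (-1 * π / 2 * Complex.I)) * (-(-1 * Complex.I)) ^ r)) * hg -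
      ((-1) ^ r * Complex.Gamma (5/2 + r) / r.factorial * (2 * π : ℂ) ^ (-(5/2) : ℂ) *
        (x ^ r / (2 * π) ^ r) * riemannZeta (5/2 + r)) * hcos
  have hRre := Complex.hasSum_re hR
  have hRre2 : HasSum (fun r : ℕ => (riemannZeta (-3 / 2 - (r : ℂ))).re * (-x) ^ r / r.factorial)
      ((A + B) * Complex.Gamma (5/2)).re := by
    convert hRre using 2 with r
    rw [Complex.re_mul_ofReal, mul_div_assoc]
  rw [hRre2.tsum_eq]
  have hx5 : (x : ℂ) ^ (-(5/2) : ℂ) * Complex.Gamma (5/2)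
      = ((x ^ (-(5/2) : ℝ) * Real.Gamma (5/2) : ℝ) : ℂ) := by
    rw [Complex.ofReal_mul, Complex.ofReal_cpow hx.le, ← Complex.Gamma_ofReal]
    push_cast; rfl
  have h := congrArg Complex.re hP
  rw [Complex.ofReal_re, show (A + (x : ℂ) ^ (-(5/2) : ℂ) + B) * Complex.Gamma (5/2)
    = (x : ℂ) ^ (-(5/2) : ℂ) * Complex.Gamma (5/2) + (A + B) * Complex.Gamma (5/2) by ring, hx5,
    Complex.add_re, Complex.ofReal_re] at h
  exact h

theorem lerch_expansion_neg_three_half (β : ℝ) (hβ : 0 < β) (hβ' : β < 2 * Real.sqrt π) :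
    (1 / Real.sqrt (2 * π)) *
        (∑' n : ℕ, ((n : ℝ) + 1) ^ ((3 : ℝ) / 2) * Real.exp (-((n : ℝ) + 1) * β ^ 2 / 2))
      = 3 / β ^ 5 + (1 / Real.sqrt (2 * π)) *
          ∑' r : ℕ, (riemannZeta (-3 / 2 - (r : ℂ))).re * (-β ^ 2 / 2) ^ r / r.factorial := by
  have hpi := Real.pi_pos
  have hx : 0 < β ^ 2 / 2 := by positivity
  have hx2 : β ^ 2 / 2 < 2 * π := by
    have h1 := Real.sq_sqrt hpi.le
    have h2 : β ^ 2 < (2 * Real.sqrt π) ^ 2 := by gcongr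
    nlinarith
  have h := aux_main hx hx2
  simp only [← mul_div_assoc, ← neg_div (2 : ℝ) (β ^ 2)] at h
  rw [h, mul_add]
  congr 1
  have hG : Real.Gamma (5/2) = 3/4 * Real.sqrt π := by
    rw [show (5/2 : ℝ) = 1/2 + 1 + 1 by norm_num, Real.Gamma_add_one (by norm_num),
      Real.Gamma_add_one (by norm_num), Real.Gamma_one_half_eq]
    ring
  have h2 : (β ^ 2 / 2) ^ (-(5/2) : ℝ) = 4 * Real.sqrt 2 / β ^ 5 := by
    have hs : Real.sqrt (β ^ 2 / 2) = β / Real.sqrt 2 := by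
      rw [Real.sqrt_div (by positivity), Real.sqrt_sq hβ.le]
    have hs2 : Real.sqrt 2 ^ 2 = 2 := Real.sq_sqrt (by norm_num)
    have h5 : Real.sqrt 2 ^ 5 = 4 * Real.sqrt 2 := by
      linear_combination (Real.sqrt 2 ^ 3 + 2 * Real.sqrt 2) * hs2
    rw [Real.rpow_neg hx.le, show (5/2 : ℝ) = (1/2) * (5 : ℕ) by norm_num,
      Real.rpow_mul hx.le, ← Real.sqrt_eq_rpow, Real.rpow_natCast, hs, div_pow, inv_div, h5]
  rw [hG, h2, Real.sqrt_mul (by norm_num)]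
  field_simp
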